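/- arXiv:2108.06754 — 2 statements merged into one kernel-verified Lean document; each statement's English description precedes it below -/
import Mathlib

section
/- (Finite-field Thomae formula.) Let α, β, γ, ρ, τ be multiplicative characters of κ with α ≠ ρ, α ≠ τ, β ≠ ε and γ ≠ ε, and set σ = ᾱβ̄γ̄ρτ. Then [g(α) / (g°(ρ)·g°(τ))] · F(α,β,γ; ρ,τ; 1) = [g(σ) / (g°(βσ)·g°(γσ))] · F(σ, ᾱρ, ᾱτ; βσ, γσ; 1). -/
/-!
Finite-field hypergeometric functions (Otsubo), basic definitions:
`κ` is a finite field with `q = Fintype.card κ` elements, `ψ` a fixed nontrivial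
additive character, multiplicative characters are `MulChar κ ℂ` (extended by `0`
on `0`, with trivial character `1`).
-/

open scoped Classical

noncomputable section

variable {κ : Type*} [Field κ] [Fintype κ]

instance : Fintype (MulChar κ ℂ) := Fintype.ofFinite _

/-- The Gauss sum `g(φ) = -∑_{x ∈ κ} ψ(x) φ(x)`. -/
def gS (ψ : AddChar κ ℂ) (φ : MulChar κ ℂ) : ℂ := -∑ x : κ, ψ x * φ x

/-- The variant `g°(φ) = q^{δ(φ)} · g(φ)`, where `δ(φ) = 1` iff `φ` is trivial. -/
def gSo (ψ : AddChar κ ℂ) (φ : MulChar κ ℂ) : ℂ :=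
  (if φ = 1 then (Fintype.card κ : ℂ) else 1) * gS ψ φ

/-- The Pochhammer symbol `(α)_ν = g(αν)/g(α)`. -/
def poch (ψ : AddChar κ ℂ) (α ν : MulChar κ ℂ) : ℂ := gS ψ (α * ν) / gS ψ α

/-- The variant Pochhammer symbol `(α)°_ν = g°(αν)/g°(α)`. -/
def pocho (ψ : AddChar κ ℂ) (α ν : MulChar κ ℂ) : ℂ := gSo ψ (α * ν) / gSo ψ α

/-- The finite hypergeometric function
`F(α₁,…,α_r; β₁,…,β_s; λ) = (1/(1-q)) ∑_ν ((α₁)_ν ⋯ (α_r)_ν / ((ε)°_ν (β₁)°_ν ⋯ (β_s)°_ν)) ν(λ)`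
(the trivial character `ε = 1` appears implicitly among the lower parameters). -/
def Fh (ψ : AddChar κ ℂ) {r s : ℕ} (A : Fin r → MulChar κ ℂ) (B : Fin s → MulChar κ ℂ)
    (l : κ) : ℂ :=
  (1 - (Fintype.card κ : ℂ))⁻¹ *
    ∑ ν : MulChar κ ℂ,
      ((∏ i, poch ψ (A i) ν) / (pocho ψ 1 ν * ∏ j, pocho ψ (B j) ν)) * ν l

lemma sum_mulChar_apply (a : κ) :
    ∑ μ : MulChar κ ℂ, μ a = if a = 1 then (Fintype.card κ : ℂ) - 1 else 0 := by
  split_ifs with ha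
  · have h := MulChar.card_eq_card_units_of_hasEnoughRootsOfUnity κ ℂ
    rw [Nat.card_eq_fintype_card, Nat.card_eq_fintype_card] at h
    simp [ha, h, Fintype.card_eq_card_units_add_one (α := κ)]
  · obtain ⟨χ, hχ⟩ := MulChar.exists_apply_ne_one_of_hasEnoughRootsOfUnity κ ℂ ha
    refine eq_zero_of_mul_eq_self_left hχ ?_
    simp only [Finset.mul_sum, ← MulChar.mul_apply]
    exact Fintype.sum_bijective _ (Group.mulLeft_bijective χ) _ _ fun χ' ↦ rfl

lemma sum_units_mulChar_mul (φ : MulChar κ ℂ) (f : κ → ℂ) :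
    ∑ u : κˣ, φ u * f u = ∑ x, φ x * f x := by
  rw [← Finset.add_sum_erase _ _ (Finset.mem_univ (0 : κ)), MulChar.map_zero, zero_mul, zero_add]
  refine Finset.sum_bij (fun u _ ↦ (u : κ)) (by simp) (fun _ _ _ _ h ↦ Units.ext h)
    (fun b hb ↦ ⟨Units.mk0 b (Finset.ne_of_mem_erase hb), by simp⟩) (by simp)

lemma mulChar_neg_one_mul_self {R : Type*} [CommRing R] (φ : MulChar R ℂ) : φ (-1) * φ (-1) = 1 := by
  rw [← map_mul]; simp

lemma mulChar_inv_neg_one {R : Type*} [Field R] (φ : MulChar R ℂ) : φ⁻¹ (-1) = φ (-1) := by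
  rw [MulChar.inv_apply', inv_neg_one]

lemma gS_eq_neg_gaussSum (ψ : AddChar κ ℂ) (φ : MulChar κ ℂ) : gS ψ φ = -gaussSum φ ψ := by
  simp only [gS, gaussSum, mul_comm]

lemma gS_eq_sum_units (ψ : AddChar κ ℂ) (φ : MulChar κ ℂ) (w : κˣ) :
    gS ψ φ = -∑ u : κˣ, φ (w * u) * ψ (w * u) := by
  rw [gS_eq_neg_gaussSum, gaussSum, ← sum_units_mulChar_mul φ ψ]
  congr 1
  simpa using (Equiv.sum_comp (Equiv.mulLeft w) fun u : κˣ ↦ φ u * ψ u).symm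

lemma gS_one {ψ : AddChar κ ℂ} (hψ : ψ ≠ 1) : gS ψ 1 = 1 := by
  rw [gS_eq_neg_gaussSum, gaussSum_one_left hψ, neg_neg]

lemma gSo_one {ψ : AddChar κ ℂ} (hψ : ψ ≠ 1) : gSo ψ 1 = Fintype.card κ := by
  simp [gSo, gS_one hψ]

lemma gSo_of_ne_one (ψ : AddChar κ ℂ) {φ : MulChar κ ℂ} (hφ : φ ≠ 1) : gSo ψ φ = gS ψ φ := by
  simp [gSo, hφ]

lemma gSo_mul_gS_inv {ψ : AddChar κ ℂ} (hψ : ψ ≠ 1) (φ : MulChar κ ℂ) :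
    gSo ψ φ * gS ψ φ⁻¹ = φ (-1) * Fintype.card κ := by
  by_cases hφ : φ = 1
  · simp [hφ, gSo_one hψ, gS_one hψ, MulChar.one_apply isUnit_one.neg]
  · rw [gSo_of_ne_one ψ hφ, gS_eq_neg_gaussSum, gS_eq_neg_gaussSum,
      ← gaussSum_mul_gaussSum_eq_card hφ (AddChar.IsPrimitive.of_ne_one hψ),
      ← mul_gaussSum_inv_eq_gaussSum φ⁻¹ ψ, mulChar_inv_neg_one]
    ring

lemma card_ne_zero_complex : (Fintype.card κ : ℂ) ≠ 0 :=
  Nat.cast_ne_zero.2 Fintype.card_ne_zero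

lemma mulChar_neg_one_ne_zero {R : Type*} [CommRing R] (φ : MulChar R ℂ) : φ (-1) ≠ 0 :=
  left_ne_zero_of_mul_eq_one (mulChar_neg_one_mul_self φ)

lemma gSo_ne_zero {ψ : AddChar κ ℂ} (hψ : ψ ≠ 1) (φ : MulChar κ ℂ) : gSo ψ φ ≠ 0 :=
  left_ne_zero_of_mul <| (gSo_mul_gS_inv hψ φ).trans_ne <|
    mul_ne_zero (mulChar_neg_one_ne_zero φ) card_ne_zero_complex

lemma gS_ne_zero {ψ : AddChar κ ℂ} (hψ : ψ ≠ 1) (φ : MulChar κ ℂ) : gS ψ φ ≠ 0 :=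
  right_ne_zero_of_mul (gSo_ne_zero hψ φ)

lemma inv_gSo {ψ : AddChar κ ℂ} (hψ : ψ ≠ 1) (φ : MulChar κ ℂ) :
    (gSo ψ φ)⁻¹ = φ (-1) * gS ψ φ⁻¹ / Fintype.card κ := by
  have h := gSo_mul_gS_inv hψ φ
  have h2 := mulChar_neg_one_mul_self φ
  have := gSo_ne_zero hψ φ
  have := card_ne_zero_complex (κ := κ)
  field_simp
  linear_combination (-(φ (-1))) * h - Fintype.card κ * h2

/-- The Jacobi sum of two nontrivial characters in terms of Gauss sums. -/
lemma sum_mulChar_mul_mulChar_one_add {ψ : AddChar κ ℂ} (hψ : ψ ≠ 1) {A E : MulChar κ ℂ}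
    (hA : A ≠ 1) (hE : E ≠ 1) :
    ∑ x, A x * E (1 + x) = -(A (-1) * gS ψ A * gS ψ E / gSo ψ (A * E)) := by
  have hJ : ∑ x, A x * E (1 + x) = A (-1) * jacobiSum A E := by
    rw [jacobiSum, Finset.mul_sum, ← Equiv.sum_comp (Equiv.neg κ)]
    refine Finset.sum_congr rfl fun x _ ↦ ?_
    rw [Equiv.neg_apply, ← neg_one_mul x, map_mul]
    ring_nf
  rw [hJ]
  by_cases h : A * E = 1
  · obtain rfl : E = A⁻¹ := eq_inv_of_mul_eq_one_right h
    have := gSo_mul_gS_inv hψ A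
    rw [gSo_of_ne_one ψ hA] at this
    rw [h, gSo_one hψ, jacobiSum_nontrivial_inv hA, mul_assoc (A (-1)), this]
    field_simp [card_ne_zero_complex (κ := κ)]
  · have hJ := jacobiSum_mul_nontrivial h ψ
    have h0 := gS_ne_zero hψ (A * E)
    rw [gSo_of_ne_one ψ h, ← mul_neg_one, ← mul_neg_one]
    field_simp
    simp only [gS_eq_neg_gaussSum]
    linear_combination (-A (-1)) * hJ

/-- A product of four Gauss sums, expanded with homogeneous coordinates `wx`, `wy`, `wz`, `w`. -/
lemma gS_mul_gS_mul_gS_inv_eq_sum (ψ : AddChar κ ℂ) (A B C μ : MulChar κ ℂ) :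
    gS ψ (A * μ) * gS ψ (B * μ) * (gS ψ μ⁻¹ * gS ψ (C * μ⁻¹)) =
      ∑ w : κˣ, ∑ x : κˣ, ∑ y : κˣ, ∑ z : κˣ,
        (A x * B y * ((A * B * C) w * ψ (w * (1 + x + y)))) *
          (ψ (w * z) * μ ((x * y * z⁻¹ : κˣ) : κ)) := by
  have h1 := gS_eq_sum_units ψ (C * μ⁻¹) 1
  rw [h1, mul_neg, mul_neg, ← mul_assoc, Finset.mul_sum, ← Finset.sum_neg_distrib]
  refine Finset.sum_congr rfl fun w _ ↦ ?_
  rw [gS_eq_sum_units ψ (A * μ) w, gS_eq_sum_units ψ (B * μ) w, gS_eq_sum_units ψ μ⁻¹ w]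
  rw [neg_mul_neg, mul_neg, neg_mul, neg_neg, Finset.sum_mul_sum, Finset.sum_mul, Finset.sum_mul]
  refine Finset.sum_congr rfl fun x _ ↦ ?_
  rw [Finset.sum_mul, Finset.sum_mul]
  refine Finset.sum_congr rfl fun y _ ↦ ?_
  rw [Finset.mul_sum, Finset.sum_mul]
  refine Finset.sum_congr rfl fun z _ ↦ ?_
  have hi (u : κˣ) : μ ((u : κ)⁻¹) = (μ u)⁻¹ :=
    eq_inv_of_mul_eq_one_left (by rw [← map_mul, inv_mul_cancel₀ u.ne_zero, map_one])
  rw [Units.val_mul, Units.val_mul, Units.val_inv_eq_inv_val, Units.val_one, one_mul, mul_add,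
    mul_add, mul_one, AddChar.map_add_eq_mul, AddChar.map_add_eq_mul]
  simp only [MulChar.mul_apply, MulChar.inv_apply', hi, map_mul A, map_mul B, map_mul μ,
    map_mul (μ⁻¹)]
  have hw : μ w ≠ 0 := (w.isUnit.map μ).ne_zero
  linear_combination A x * B y * (A w * B w * C w * (ψ w * ψ (w * x) * ψ (w * y))) *
    (ψ (w * z) * (μ x * μ y * (μ z)⁻¹)) * (μ w * (μ w)⁻¹ + 1) * mul_inv_cancel₀ hw

/-- The unfolded Mellin–Barnes sum of four Gauss sums. -/
lemma sum_gS_mul_gS_mul_gS_inv (ψ : AddChar κ ℂ) (A B C : MulChar κ ℂ) :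
    ∑ μ, gS ψ (A * μ) * gS ψ (B * μ) * (gS ψ μ⁻¹ * gS ψ (C * μ⁻¹)) =
      (Fintype.card κ - 1) * ∑ x, ∑ y, A x * B y *
        ∑ w, (A * B * C) w * ψ (w * ((1 + x) * (1 + y))) := by
  have hz (w x y : κˣ) : ∑ z : κˣ, ∑ μ : MulChar κ ℂ, ψ (w * z) * μ ((x * y * z⁻¹ : κˣ) : κ) =
      (Fintype.card κ - 1) * ψ (w * (x * y)) := by
    simp_rw [← Finset.mul_sum, sum_mulChar_apply]
    rw [Finset.sum_eq_single (x * y)]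
    · rw [if_pos (by rw [mul_inv_cancel, Units.val_one]), mul_comm]
      push_cast
      rfl
    · intro z _ hz
      rw [if_neg, mul_zero]
      intro h
      rw [Units.val_eq_one, mul_inv_eq_one] at h
      exact hz h.symm
    · simp
  simp_rw [gS_mul_gS_mul_gS_inv_eq_sum]
  calc _ = ∑ w : κˣ, ∑ x : κˣ, ∑ y : κˣ, ∑ z : κˣ, ∑ μ : MulChar κ ℂ,
          (A x * B y * ((A * B * C) w * ψ (w * (1 + x + y)))) *
            (ψ (w * z) * μ ((x * y * z⁻¹ : κˣ) : κ)) := by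
        rw [Finset.sum_comm]
        refine Finset.sum_congr rfl fun w _ ↦ ?_
        rw [Finset.sum_comm]
        refine Finset.sum_congr rfl fun x _ ↦ ?_
        rw [Finset.sum_comm]
        refine Finset.sum_congr rfl fun y _ ↦ ?_
        rw [Finset.sum_comm]
    _ = ∑ w : κˣ, ∑ x : κˣ, ∑ y : κˣ, (Fintype.card κ - 1) * (A x * (B y *
          ((A * B * C) w * ψ (w * ((1 + x) * (1 + y)))))) := by
        refine Finset.sum_congr rfl fun w _ ↦ Finset.sum_congr rfl fun x _ ↦
          Finset.sum_congr rfl fun y _ ↦ ?_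
        have hP := congrArg (A x * B y * ((A * B * C) w * ψ (w * (1 + x + y))) * ·) (hz w x y)
        simp only [Finset.mul_sum (Finset.univ : Finset κˣ),
          Finset.mul_sum (Finset.univ : Finset (MulChar κ ℂ))] at hP
        rw [hP, show (w : κ) * ((1 + x) * (1 + y)) = w * (1 + x + y) + w * (x * y) by ring,
          AddChar.map_add_eq_mul]
        ring
    _ = _ := by
        simp only [mul_assoc (A _), ← Finset.mul_sum]
        simp only [← sum_units_mulChar_mul]
        rw [Finset.sum_comm]
        simp only [Finset.mul_sum]
        refine Finset.sum_congr rfl fun x _ ↦ ?_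
        rw [Finset.sum_comm]

/-- The finite-field analogue of Gauss's summation of `₂F₁(1)`. -/
lemma sum_gS_mul_gS_div_gSo {ψ : AddChar κ ℂ} (hψ : ψ ≠ 1) {A B : MulChar κ ℂ}
    (hA : A ≠ 1) (hB : B ≠ 1) (C : MulChar κ ℂ) :
    ∑ μ, gS ψ (A * μ) * gS ψ (B * μ) / (gSo ψ μ * gSo ψ (C * μ)) =
      (1 - Fintype.card κ) / Fintype.card κ * (gS ψ A * gS ψ B * gS ψ (C * A⁻¹ * B⁻¹) /
        (gSo ψ (C * A⁻¹) * gSo ψ (C * B⁻¹))) := by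
  have hq := card_ne_zero_complex (κ := κ)
  have hterm (μ : MulChar κ ℂ) : gS ψ (A * μ) * gS ψ (B * μ) / (gSo ψ μ * gSo ψ (C * μ)) =
      C (-1) / Fintype.card κ ^ 2 *
        (gS ψ (A * μ) * gS ψ (B * μ) * (gS ψ μ⁻¹ * gS ψ (C⁻¹ * μ⁻¹))) := by
    rw [div_eq_mul_inv, mul_inv, inv_gSo hψ, inv_gSo hψ, MulChar.mul_apply, mul_inv C]
    have := mulChar_neg_one_mul_self μ
    field_simp
    linear_combination gS ψ (A * μ) * gS ψ (B * μ) * gS ψ μ⁻¹ * gS ψ (C⁻¹ * μ⁻¹) * C (-1) * this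
  simp_rw [hterm]
  rw [← Finset.mul_sum, sum_gS_mul_gS_mul_gS_inv]
  by_cases hD : A * B * C⁻¹ = 1
  · obtain rfl : A * B = C := mul_inv_eq_one.1 hD
    have hw (t : κ) : ∑ w, (A * B * (A * B)⁻¹) w * ψ (w * t) =
        (if t = 0 then (Fintype.card κ : ℂ) else 0) - 1 := by
      have h := AddChar.sum_mulShift t (AddChar.IsPrimitive.of_ne_one hψ)
      rw [← Finset.add_sum_erase _ _ (Finset.mem_univ (0 : κ))] at h ⊢
      rw [zero_mul, AddChar.map_zero_eq_one] at h
      rw [mul_inv_cancel, MulChar.map_zero, zero_mul, zero_add]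
      push_cast at h
      rw [← h, add_sub_cancel_left]
      refine Finset.sum_congr rfl fun w hw ↦ ?_
      rw [MulChar.one_apply (Ne.isUnit (Finset.ne_of_mem_erase hw)), one_mul]
    have hS : ∑ x, ∑ y, A x * B y * ∑ w, (A * B * (A * B)⁻¹) w * ψ (w * ((1 + x) * (1 + y))) =
        -(Fintype.card κ * (A (-1) * B (-1))) := by
      have hx (x : κ) : ∑ y, A x * B y *
          ∑ w, (A * B * (A * B)⁻¹) w * ψ (w * ((1 + x) * (1 + y))) =
            if x = -1 then 0 else A x * (Fintype.card κ * B (-1)) := by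
        simp_rw [hw, mul_eq_zero, add_eq_zero_iff_eq_neg', mul_sub, Finset.sum_sub_distrib]
        split_ifs with h
        · simp [h, ← Finset.mul_sum, ← Finset.sum_mul, MulChar.sum_eq_zero_of_ne_one hB]
        · simp [h, ← Finset.mul_sum, MulChar.sum_eq_zero_of_ne_one hB]
          ring
      simp_rw [hx]
      have hsum := MulChar.sum_eq_zero_of_ne_one hA
      rw [← Finset.add_sum_erase _ _ (Finset.mem_univ (-1 : κ))] at hsum ⊢
      rw [if_pos rfl, Finset.sum_congr rfl fun x hx ↦ if_neg (Finset.ne_of_mem_erase hx),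
        ← Finset.sum_mul]
      linear_combination (Fintype.card κ * B (-1)) * hsum
    rw [hS, show A * B * A⁻¹ = B by rw [mul_comm A, mul_inv_cancel_right], mul_inv_cancel_right,
      mul_inv_cancel, gS_one hψ, gSo_of_ne_one ψ hA, gSo_of_ne_one ψ hB, MulChar.mul_apply]
    have := gS_ne_zero hψ A
    have := gS_ne_zero hψ B
    field_simp
    have h1 := mulChar_neg_one_mul_self A
    have h2 := mulChar_neg_one_mul_self B
    linear_combination (1 - Fintype.card κ) * (B (-1) * B (-1)) * h1 + (1 - Fintype.card κ) * h2
  · set D := A * B * C⁻¹ with hDdef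
    have hw (t : κ) : ∑ w, D w * ψ (w * t) = -(D⁻¹ t * gS ψ D) := by
      rw [gS_eq_neg_gaussSum]
      rcases eq_or_ne t 0 with rfl | ht
      · simp [MulChar.sum_eq_zero_of_ne_one hD, MulChar.map_zero]
      · have := gaussSum_mulShift_eq D ψ (Units.mk0 t ht)
        simpa [gaussSum, AddChar.mulShift_apply, mul_comm] using this
    have hS : ∑ x, ∑ y, A x * B y * ∑ w, D w * ψ (w * ((1 + x) * (1 + y))) =
        -gS ψ D * ((∑ x, A x * D⁻¹ (1 + x)) * ∑ y, B y * D⁻¹ (1 + y)) := by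
      simp_rw [hw, Finset.sum_mul_sum, Finset.mul_sum, map_mul]
      refine Finset.sum_congr rfl fun x _ ↦ Finset.sum_congr rfl fun y _ ↦ ?_
      ring
    have hD' : D⁻¹ ≠ 1 := inv_ne_one.2 hD
    rw [hS, sum_mulChar_mul_mulChar_one_add hψ hA hD', sum_mulChar_mul_mulChar_one_add hψ hB hD']
    have hAB : A * B = D * C := by rw [hDdef, inv_mul_cancel_right]
    rw [show A * D⁻¹ = C * B⁻¹ by rw [mul_inv_eq_iff_eq_mul, mul_right_comm, eq_mul_inv_iff_mul_eq,
        hAB, mul_comm],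
      show B * D⁻¹ = C * A⁻¹ by rw [mul_inv_eq_iff_eq_mul, mul_right_comm, eq_mul_inv_iff_mul_eq,
        mul_comm B, hAB, mul_comm],
      show C * A⁻¹ * B⁻¹ = D⁻¹ by rw [mul_assoc, ← mul_inv, hAB, mul_inv, mul_comm,
        inv_mul_cancel_right]]
    have hDD := gSo_mul_gS_inv hψ D
    rw [gSo_of_ne_one ψ hD] at hDD
    have hsign : C (-1) * A (-1) * B (-1) * D (-1) = 1 := by
      rw [← MulChar.mul_apply, ← MulChar.mul_apply, ← MulChar.mul_apply,
        show C * A * B * D = (A * B) * (A * B) by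
          rw [mul_assoc C, mul_comm C, mul_assoc, mul_comm C, ← hAB],
        MulChar.mul_apply, mulChar_neg_one_mul_self]
    have := gSo_ne_zero hψ (C * A⁻¹)
    have := gSo_ne_zero hψ (C * B⁻¹)
    field_simp
    linear_combination (1 - Fintype.card κ) * C (-1) * A (-1) * B (-1) *
      gS ψ A * gS ψ B * gS ψ D⁻¹ * hDD +
      (1 - Fintype.card κ) * Fintype.card κ * gS ψ A * gS ψ B * gS ψ D⁻¹ * hsign

lemma Fh_three_two_one {ψ : AddChar κ ℂ} (hψ : ψ ≠ 1) (a b c d e : MulChar κ ℂ) :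
    gS ψ a / (gSo ψ d * gSo ψ e) * Fh ψ ![a, b, c] ![d, e] 1 =
      Fintype.card κ / (1 - Fintype.card κ) * (gS ψ b * gS ψ c)⁻¹ *
        ∑ ν, gS ψ (b * ν) * gS ψ (c * ν) / gSo ψ ν *
          (gS ψ (a * ν) / (gSo ψ (d * ν) * gSo ψ (e * ν))) := by
  have := gS_ne_zero hψ a
  have := gSo_ne_zero hψ d
  have := gSo_ne_zero hψ e
  have hF : Fh ψ ![a, b, c] ![d, e] 1 = (1 - (Fintype.card κ : ℂ))⁻¹ * ∑ ν,
      (poch ψ a ν * poch ψ b ν * poch ψ c ν) /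
        (pocho ψ 1 ν * (pocho ψ d ν * pocho ψ e ν)) := by
    simp [Fh, Fin.prod_univ_three, Fin.prod_univ_two]
  rw [hF, ← mul_assoc, Finset.mul_sum, Finset.mul_sum]
  refine Finset.sum_congr rfl fun ν _ ↦ ?_
  simp only [poch, pocho, one_mul, gSo_one hψ]
  generalize gS ψ a = x at *
  generalize gSo ψ d = y at *
  generalize gSo ψ e = z at *
  generalize gS ψ b = s, gS ψ c = t, gS ψ (a * ν) = x', gS ψ (b * ν) = s', gS ψ (c * ν) = t',
    gSo ψ ν = n, gSo ψ (d * ν) = y', gSo ψ (e * ν) = z', (Fintype.card κ : ℂ) = q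
  field_simp

/-- finite-field Thomae formula: for `α ≠ ρ`, `α ≠ τ`, `β ≠ ε`, `γ ≠ ε`
and `σ = ᾱβ̄γ̄ρτ`,
`(g(α)/(g°(ρ)g°(τ))) F(α,β,γ;ρ,τ;1) = (g(σ)/(g°(βσ)g°(γσ))) F(σ,ᾱρ,ᾱτ;βσ,γσ;1)`. -/
theorem stmt_14 (ψ : AddChar κ ℂ) (hψ : ψ ≠ 1) (α β γ ρ τ σ : MulChar κ ℂ)
    (hαρ : α ≠ ρ) (hατ : α ≠ τ) (hβ : β ≠ 1) (hγ : γ ≠ 1)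
    (hσ : σ = α⁻¹ * β⁻¹ * γ⁻¹ * ρ * τ) :
    gS ψ α / (gSo ψ ρ * gSo ψ τ) * Fh ψ ![α, β, γ] ![ρ, τ] 1 =
      gS ψ σ / (gSo ψ (β * σ) * gSo ψ (γ * σ)) *
        Fh ψ ![σ, α⁻¹ * ρ, α⁻¹ * τ] ![β * σ, γ * σ] 1 := by
  have hA : α⁻¹ * ρ ≠ 1 := fun h ↦ hαρ (inv_mul_eq_one.1 h)
  have hB : α⁻¹ * τ ≠ 1 := fun h ↦ hατ (inv_mul_eq_one.1 h)
  have hA0 := gS_ne_zero hψ (α⁻¹ * ρ)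
  have hB0 := gS_ne_zero hψ (α⁻¹ * τ)
  have hβ0 := gS_ne_zero hψ β
  have hγ0 := gS_ne_zero hψ γ
  have hK : (1 - (Fintype.card κ : ℂ)) / Fintype.card κ ≠ 0 := by
    refine div_ne_zero (sub_ne_zero.2 ?_) card_ne_zero_complex
    exact_mod_cast (Fintype.one_lt_card (α := κ)).ne
  set C := α⁻¹ * ρ * τ with hC
  have gauss_left (ν : MulChar κ ℂ) := sum_gS_mul_gS_div_gSo hψ hA hB (C * ν)
  have gauss_right (μ : MulChar κ ℂ) := sum_gS_mul_gS_div_gSo hψ hβ hγ (C * μ)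
  have e1 (ν : MulChar κ ℂ) : C * ν * (α⁻¹ * ρ)⁻¹ = τ * ν := by
    rw [mul_inv_eq_iff_eq_mul, hC]; ac_rfl
  have e2 (ν : MulChar κ ℂ) : C * ν * (α⁻¹ * τ)⁻¹ = ρ * ν := by
    rw [mul_inv_eq_iff_eq_mul, hC]; ac_rfl
  have e3 (ν : MulChar κ ℂ) : τ * ν * (α⁻¹ * τ)⁻¹ = α * ν := by
    rw [mul_inv_eq_iff_eq_mul, mul_mul_mul_comm, mul_comm ν, ← mul_assoc, mul_inv_cancel, one_mul]
  have e4 (μ : MulChar κ ℂ) : C * μ * β⁻¹ = γ * σ * μ := by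
    rw [mul_inv_eq_iff_eq_mul, hC, hσ]
    calc _ = (γ * γ⁻¹) * (β * β⁻¹) * (α⁻¹ * ρ * τ * μ) := by simp
      _ = _ := by ac_rfl
  have e5 (μ : MulChar κ ℂ) : C * μ * γ⁻¹ = β * σ * μ := by
    rw [mul_inv_eq_iff_eq_mul, hC, hσ]
    calc _ = (γ * γ⁻¹) * (β * β⁻¹) * (α⁻¹ * ρ * τ * μ) := by simp
      _ = _ := by ac_rfl
  have e6 (μ : MulChar κ ℂ) : γ * σ * μ * γ⁻¹ = σ * μ := by
    rw [mul_inv_eq_iff_eq_mul]; ac_rfl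
  simp only [e1, e2, e3] at gauss_left
  simp only [e4, e5, e6] at gauss_right
  set K := (1 - (Fintype.card κ : ℂ)) / Fintype.card κ
  have hl (ν : MulChar κ ℂ) : gS ψ (α * ν) / (gSo ψ (ρ * ν) * gSo ψ (τ * ν)) =
      (K * (gS ψ (α⁻¹ * ρ) * gS ψ (α⁻¹ * τ)))⁻¹ * ∑ μ, gS ψ (α⁻¹ * ρ * μ) *
        gS ψ (α⁻¹ * τ * μ) / (gSo ψ μ * gSo ψ (C * ν * μ)) := by
    rw [gauss_left]; field_simp
  have hr (μ : MulChar κ ℂ) : gS ψ (σ * μ) / (gSo ψ (β * σ * μ) * gSo ψ (γ * σ * μ)) =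
      (K * (gS ψ β * gS ψ γ))⁻¹ * ∑ ν, gS ψ (β * ν) *
        gS ψ (γ * ν) / (gSo ψ ν * gSo ψ (C * μ * ν)) := by
    rw [gauss_right]; field_simp
  rw [Fh_three_two_one hψ, Fh_three_two_one hψ]
  simp_rw [hl, hr, Finset.mul_sum]
  rw [Finset.sum_comm]
  refine Finset.sum_congr rfl fun μ _ ↦ Finset.sum_congr rfl fun ν _ ↦ ?_
  rw [mul_right_comm C μ ν]
  simp only [mul_inv, div_eq_mul_inv]
  ring

end
end

section
/- (Finite-field quadratic transformation of Gauss.) Assume the characteristic p of κ is odd and let η be the quadratic character of κ. Let α, β be multiplicative characters of κ with α² ≠ ε and β ≠ ε. Then for every λ ∈ κ with λ ≠ −1: α²(1+λ) · F(α², β; α²β̄; λ) = F(α, αη; α²β̄; 1 − ((1−λ)/(1+λ))²). -/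
/-!
Finite-field hypergeometric functions (Otsubo), basic definitions:
`κ` is a finite field with `q = Fintype.card κ` elements, `ψ` a fixed nontrivial
additive character, multiplicative characters are `MulChar κ ℂ` (extended by `0`
on `0`, with trivial character `1`).
-/

open scoped Classical

noncomputable section

variable {κ : Type*} [Field κ] [Fintype κ]

section Character

/-- Orthogonality of the multiplicative characters, summed over the characters. -/
lemma sum_mulChar_apply_s17 {a : κ} (ha : a ≠ 1) : ∑ ν : MulChar κ ℂ, ν a = 0 := by
  obtain ⟨χ, hχ⟩ := MulChar.exists_apply_ne_one_of_hasEnoughRootsOfUnity κ ℂ ha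
  refine eq_zero_of_mul_eq_self_left hχ ?_
  rw [Finset.mul_sum]
  exact Fintype.sum_bijective _ (Group.mulLeft_bijective χ) _ _ fun ν => by simp

lemma card_mulChar : (Fintype.card (MulChar κ ℂ) : ℂ) = Fintype.card κ - 1 := by
  have h := MulChar.card_eq_card_units_of_hasEnoughRootsOfUnity κ ℂ
  rw [Nat.card_eq_fintype_card, Nat.card_eq_fintype_card] at h
  rw [h, Fintype.card_eq_card_units_add_one (α := κ)]
  simp

/-- Mellin inversion on the multiplicative group of a finite field. -/
lemma sum_mellin_mul (f : κ → ℂ) {l : κ} (hl : l ≠ 0) :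
    ∑ ν : MulChar κ ℂ, (∑ x, ν⁻¹ x * f x) * ν l = (Fintype.card κ - 1) * f l := by
  have h (x : κ) : ∑ ν : MulChar κ ℂ, ν⁻¹ x * f x * ν l =
      if x = l then (Fintype.card κ - 1) * f l else 0 := by
    have h' (ν : MulChar κ ℂ) : ν⁻¹ x * f x * ν l = ν (x⁻¹ * l) * f x := by
      rw [MulChar.inv_apply', map_mul]; ring
    simp_rw [h', ← Finset.sum_mul]
    split_ifs with hxl
    · subst hxl
      simp [inv_mul_cancel₀ hl, ← card_mulChar]
    · rw [sum_mulChar_apply_s17, zero_mul]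
      intro h1
      rcases eq_or_ne x 0 with rfl | hx
      · simp at h1
      · exact hxl (by field_simp at h1; exact h1.symm)
  simp_rw [Finset.sum_mul]
  rw [Finset.sum_comm]
  simp_rw [h]
  simp

/-- A character of order two is unique. -/
lemma eq_of_sq_eq_one {χ η : MulChar κ ℂ} (hχ : χ ^ 2 = 1) (hχ1 : χ ≠ 1) (hη : η ^ 2 = 1)
    (hη1 : η ≠ 1) : χ = η := by
  obtain ⟨g, hg⟩ := IsCyclic.exists_generator (α := κˣ)
  have key {φ : MulChar κ ℂ} (hφ : φ ^ 2 = 1) (hφ1 : φ ≠ 1) : φ g = -1 := by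
    have h : φ g ^ 2 = 1 := by rw [← MulChar.pow_apply_coe, hφ, MulChar.one_apply_coe]
    refine (eq_or_eq_neg_of_sq_eq_sq _ _ (by rw [h, one_pow])).resolve_left fun h1 => ?_
    exact hφ1 ((MulChar.eq_iff hg _ _).mpr (by rw [h1, MulChar.one_apply_coe]))
  exact (MulChar.eq_iff hg _ _).mpr (by rw [key hχ hχ1, key hη hη1])

lemma eq_quadraticChar (hp : ringChar κ ≠ 2) {η : MulChar κ ℂ} (hη : η ^ 2 = 1) (hη1 : η ≠ 1) :
    η = (quadraticChar κ).ringHomComp (Int.castRingHom ℂ) := by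
  refine eq_of_sq_eq_one hη hη1 ((quadraticChar_isQuadratic κ).comp _).sq_eq_one ?_
  exact (MulChar.ringHomComp_ne_one_iff Int.cast_injective).mpr (quadraticChar_ne_one hp)

/-- Summing over squares amounts to weighting by `1 + η`. -/
lemma sum_comp_sq (hp : ringChar κ ≠ 2) {η : MulChar κ ℂ} (hη : η ^ 2 = 1) (hη1 : η ≠ 1)
    (f : κ → ℂ) : ∑ u, f (u ^ 2) = ∑ w, (1 + η w) * f w := by
  rw [← Finset.sum_fiberwise (s := Finset.univ) (g := fun u : κ => u ^ 2)]
  refine Finset.sum_congr rfl fun w _ => ?_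
  have hc := quadraticChar_card_sqrts hp w
  rw [Finset.sum_congr rfl (g := fun _ => f w)
    (fun u hu => by rw [(Finset.mem_filter.mp hu).2]), Finset.sum_const, nsmul_eq_mul,
    eq_quadraticChar hp hη hη1]
  congr 1
  rw [MulChar.ringHomComp_apply, Int.coe_castRingHom]
  have : ((Finset.univ.filter fun u : κ => u ^ 2 = w).card : ℤ) = quadraticChar κ w + 1 := by
    rw [← hc]
    congr 2
    ext; simp
  have h := congrArg (Int.cast : ℤ → ℂ) this
  push_cast at h
  rw [add_comm, ← h]

end Character

section Gauss

variable {ψ : AddChar κ ℂ}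

lemma jacobiSum_self_mul (hp : ringChar κ ≠ 2) {η : MulChar κ ℂ} (hη : η ^ 2 = 1) (hη1 : η ≠ 1)
    {χ : MulChar κ ℂ} (hχ : χ ≠ 1) : χ 4 * jacobiSum χ χ = jacobiSum χ η := by
  have h2 : (2 : κ) ≠ 0 := Ring.two_ne_zero hp
  have hs : ∑ w, χ (1 - w) = 0 := by
    rw [← MulChar.sum_eq_zero_of_ne_one hχ]
    exact (Equiv.subLeft (1 : κ)).sum_comp (fun w => χ w)
  calc χ 4 * jacobiSum χ χ = ∑ u, χ (1 - u ^ 2) := by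
        rw [jacobiSum, Finset.mul_sum]
        refine Fintype.sum_bijective (fun t : κ => 1 - 2 * t)
          (((Equiv.mulLeft₀ 2 h2).trans (Equiv.subLeft 1)).bijective) _ _ fun t => ?_
        rw [← map_mul, ← map_mul]
        congr 1
        ring
    _ = ∑ w, (1 + η w) * χ (1 - w) := sum_comp_sq hp hη hη1 fun w => χ (1 - w)
    _ = jacobiSum χ η := by
        rw [jacobiSum_comm, jacobiSum]
        simp_rw [add_mul, one_mul]
        rw [Finset.sum_add_distrib, hs, zero_add]

lemma gaussSum_ne_zero (hψ : ψ ≠ 1) (χ : MulChar κ ℂ) : gaussSum χ ψ ≠ 0 := by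
  rcases eq_or_ne χ 1 with rfl | hχ
  · rw [gaussSum_one_left hψ]; norm_num
  · exact gaussSum_ne_zero_of_nontrivial (by simp) hχ (AddChar.IsPrimitive.of_ne_one hψ)

/-- The Hasse–Davenport duplication formula. -/
lemma gaussSum_mul_gaussSum_quadratic (hp : ringChar κ ≠ 2) (hψ : ψ ≠ 1) {η : MulChar κ ℂ}
    (hη : η ^ 2 = 1) (hη1 : η ≠ 1) (χ : MulChar κ ℂ) :
    χ 4 * (gaussSum χ ψ * gaussSum (χ * η) ψ) = gaussSum (χ ^ 2) ψ * gaussSum η ψ := by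
  have h2 : (2 : κ) ≠ 0 := Ring.two_ne_zero hp
  have h4 : (4 : κ) = 2 ^ 2 := by norm_num
  rcases eq_or_ne χ 1 with rfl | hχ
  · rw [MulChar.one_apply (by rw [h4]; exact (h2.isUnit.pow 2))]
    simp
  rcases eq_or_ne (χ ^ 2) 1 with hχ2 | hχ2
  · obtain rfl := eq_of_sq_eq_one hχ2 hχ hη hη1
    rw [h4, map_pow, ← MulChar.pow_apply' _ two_ne_zero, hχ2, ← sq, hχ2,
      MulChar.one_apply h2.isUnit]
    ring
  have hχη : χ * η ≠ 1 := fun h => hχ2 (by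
    rw [← mul_one (χ ^ 2), show (1 : MulChar κ ℂ) = η ^ 2 from hη.symm, ← mul_pow, h, one_pow, hη])
  have e1 := jacobiSum_mul_nontrivial (χ := χ) (φ := χ) (by rwa [← sq]) ψ
  have e2 := jacobiSum_mul_nontrivial hχη ψ
  have e3 := jacobiSum_self_mul hp hη hη1 hχ
  rw [← sq χ] at e1
  refine mul_left_cancel₀ (gaussSum_ne_zero hψ χ) ?_
  linear_combination (-χ 4 * gaussSum (χ * η) ψ) * e1 + gaussSum (χ ^ 2) ψ * e2 +
    gaussSum (χ ^ 2) ψ * gaussSum (χ * η) ψ * e3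

lemma sum_mul_addChar_mul (χ : MulChar κ ℂ) {a : κ} (ha : a ≠ 0) :
    ∑ x, χ x * ψ (a * x) = χ⁻¹ a * gaussSum χ ψ :=
  gaussSum_mulShift_eq χ ψ (Units.mk0 a ha)

/-- The inverse of a nontrivial character as a Fourier transform. -/
lemma gaussSum_mul_inv_apply {β : MulChar κ ℂ} (hβ : β ≠ 1) (y : κ) :
    gaussSum β ψ * β⁻¹ y = ∑ u, β u * ψ (y * u) := by
  rcases eq_or_ne y 0 with rfl | hy
  · simp [MulChar.sum_eq_zero_of_ne_one hβ, MulChar.map_zero]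
  · rw [sum_mul_addChar_mul β hy, mul_comm]

lemma gS_eq (χ : MulChar κ ℂ) : gS ψ χ = -gaussSum χ ψ := by
  simp [gS, gaussSum, mul_comm]

lemma gSo_mul_gaussSum_inv (hψ : ψ ≠ 1) (χ : MulChar κ ℂ) :
    gSo ψ χ * gaussSum χ⁻¹ ψ = -(χ (-1) * Fintype.card κ) := by
  rw [gSo, gS_eq]
  split_ifs with h
  · subst h
    rw [inv_one, gaussSum_one_left hψ, MulChar.one_apply isUnit_one.neg]
    ring
  · have e := gaussSum_mul_gaussSum_eq_card h (AddChar.IsPrimitive.of_ne_one hψ)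
    have e' := mul_gaussSum_inv_eq_gaussSum χ⁻¹ ψ
    have e'' : χ⁻¹ (-1) = χ (-1) := by rw [MulChar.inv_apply']; norm_num
    rw [← e', e'']
    linear_combination (-χ (-1)) * e

lemma apply_neg_one_mul_self (χ : MulChar κ ℂ) : χ (-1) * χ (-1) = 1 := by
  rw [← map_mul]; simp

lemma pocho_inv (hψ : ψ ≠ 1) (γ ν : MulChar κ ℂ) :
    (pocho ψ γ ν)⁻¹ = ν (-1) * (gaussSum (γ⁻¹ * ν⁻¹) ψ / gaussSum γ⁻¹ ψ) := by
  have hq : (Fintype.card κ : ℂ) ≠ 0 := by simp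
  have e1 := gSo_mul_gaussSum_inv hψ γ
  have e2 := gSo_mul_gaussSum_inv hψ (γ * ν)
  have n1 := gaussSum_ne_zero hψ γ⁻¹
  have n2 := gaussSum_ne_zero hψ (γ * ν)⁻¹
  have s1 := apply_neg_one_mul_self γ
  have s2 := apply_neg_one_mul_self ν
  have nγ : γ (-1) ≠ 0 := left_ne_zero_of_mul_eq_one s1
  have nν : ν (-1) ≠ 0 := left_ne_zero_of_mul_eq_one s2
  rw [← eq_div_iff n1] at e1
  rw [← eq_div_iff n2] at e2
  rw [pocho, e1, e2, MulChar.mul_apply, ← mul_inv]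
  field_simp
  linear_combination (-1 : ℂ) * s2

lemma Fh_two_one (hψ : ψ ≠ 1) (a b c : MulChar κ ℂ) (l : κ) :
    Fh ψ ![a, b] ![c] l = (Fintype.card κ - 1 : ℂ)⁻¹ * ∑ ν : MulChar κ ℂ,
      gaussSum (a * ν) ψ * gaussSum (b * ν) ψ * gaussSum ν⁻¹ ψ * gaussSum (c⁻¹ * ν⁻¹) ψ /
        (gaussSum a ψ * gaussSum b ψ * gaussSum c⁻¹ ψ) * ν l := by
  rw [Fh, ← neg_sub, inv_neg, neg_mul, ← mul_neg, ← Finset.sum_neg_distrib]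
  congr 1
  refine Finset.sum_congr rfl fun ν _ => ?_
  have s := apply_neg_one_mul_self ν
  rw [div_eq_mul_inv, mul_inv, Fin.prod_univ_two, Fin.prod_univ_one]
  simp only [Matrix.cons_val_zero, Matrix.cons_val_one]
  rw [pocho_inv hψ, pocho_inv hψ, inv_one, one_mul, gaussSum_one_left hψ]
  simp only [poch, gS_eq, neg_div_neg_eq]
  linear_combination (gaussSum (a * ν) ψ * gaussSum (b * ν) ψ * gaussSum ν⁻¹ ψ *
    gaussSum (c⁻¹ * ν⁻¹) ψ / (gaussSum a ψ * gaussSum b ψ * gaussSum c⁻¹ ψ) * ν l) * s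

/-- The Mellin transform of `x ↦ β⁻¹ (a + x * c)`, for `c ≠ 0`. -/
lemma mellin_inv_affine {β : MulChar κ ℂ} (hβ : β ≠ 1) (ν : MulChar κ ℂ) (a : κ) {c : κ}
    (hc : c ≠ 0) : gaussSum β ψ * ∑ x, ν⁻¹ x * β⁻¹ (a + x * c) =
      ν c * gaussSum ν⁻¹ ψ * ∑ u, (β * ν) u * ψ (a * u) := by
  calc gaussSum β ψ * ∑ x, ν⁻¹ x * β⁻¹ (a + x * c)
      = ∑ x, ∑ u, ν⁻¹ x * (β u * ψ ((a + x * c) * u)) := by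
        simp_rw [Finset.mul_sum, mul_left_comm (gaussSum β ψ), gaussSum_mul_inv_apply hβ,
          Finset.mul_sum]
    _ = ∑ u, β u * ψ (a * u) * ∑ x, ν⁻¹ x * ψ (c * u * x) := by
        rw [Finset.sum_comm]
        simp_rw [Finset.mul_sum]
        refine Finset.sum_congr rfl fun u _ => Finset.sum_congr rfl fun x _ => ?_
        rw [show (a + x * c) * u = a * u + c * u * x by ring, AddChar.map_add_eq_mul]
        ring
    _ = _ := by
        rw [Finset.mul_sum]
        refine Finset.sum_congr rfl fun u _ => ?_
        rcases eq_or_ne u 0 with rfl | hu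
        · simp [MulChar.map_zero]
        · rw [sum_mul_addChar_mul _ (mul_ne_zero hc hu), inv_inv, map_mul ν, MulChar.mul_apply]
          ring

lemma sum_mul_sum_one_sub (χ φ : MulChar κ ℂ) :
    ∑ s, χ s * ∑ u, φ u * ψ ((1 - s) * u) =
      χ (-1) * gaussSum χ ψ * gaussSum (φ * χ⁻¹) ψ := by
  calc ∑ s, χ s * ∑ u, φ u * ψ ((1 - s) * u)
      = ∑ u, φ u * ψ u * ∑ s, χ s * ψ (-u * s) := by
        simp_rw [Finset.mul_sum]
        rw [Finset.sum_comm]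
        refine Finset.sum_congr rfl fun u _ => Finset.sum_congr rfl fun s _ => ?_
        rw [show (1 - s) * u = u + -u * s by ring, AddChar.map_add_eq_mul]
        ring
    _ = _ := by
        rw [show gaussSum (φ * χ⁻¹) ψ = ∑ u, (φ * χ⁻¹) u * ψ u from rfl, Finset.mul_sum]
        refine Finset.sum_congr rfl fun u _ => ?_
        rcases eq_or_ne u 0 with rfl | hu
        · simp [MulChar.map_zero]
        · have h : χ⁻¹ (-1) = χ (-1) := by rw [MulChar.inv_apply']; norm_num
          rw [sum_mul_addChar_mul _ (neg_ne_zero.mpr hu), MulChar.mul_apply, neg_eq_neg_one_mul u,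
            map_mul χ⁻¹, h]
          ring

lemma mul_sum_mul_sum_comm (c : ℂ) (f : κ → ℂ) (F : κ → κ → ℂ) :
    c * ∑ x, f x * ∑ t, F x t = ∑ t, c * ∑ x, f x * F x t := by
  simp_rw [Finset.mul_sum]
  exact Finset.sum_comm

lemma mellin_euler_sum (α : MulChar κ ℂ) {β : MulChar κ ℂ} (hβ : β ≠ 1) (ν : MulChar κ ℂ) :
    gaussSum β ψ ^ 2 * ∑ x, ν⁻¹ x * ∑ t, (α ^ 2) t * (β⁻¹ (1 - t) * β⁻¹ (1 - x * t)) =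
      gaussSum (α ^ 2 * ν) ψ * gaussSum (β * ν) ψ * gaussSum ν⁻¹ ψ *
        gaussSum ((α ^ 2 * β⁻¹)⁻¹ * ν⁻¹) ψ := by
  have h (t : κ) : gaussSum β ψ * ∑ x, ν⁻¹ x * ((α ^ 2) t * (β⁻¹ (1 - t) * β⁻¹ (1 - x * t))) =
      ν (-1) * gaussSum ν⁻¹ ψ * gaussSum (β * ν) ψ * ((α ^ 2 * ν) t * β⁻¹ (1 - t)) := by
    rcases eq_or_ne t 0 with rfl | ht
    · simp [MulChar.map_zero]
    have e := mellin_inv_affine (ψ := ψ) hβ ν 1 (neg_ne_zero.mpr ht)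
    simp_rw [one_mul, mul_neg, ← sub_eq_add_neg] at e
    rw [neg_eq_neg_one_mul t, map_mul] at e
    simp_rw [mul_left_comm (ν⁻¹ _), ← Finset.mul_sum]
    rw [mul_left_comm, mul_left_comm (gaussSum β ψ), e, MulChar.mul_apply, ← gaussSum]
    ring
  have e := sum_mul_sum_one_sub (ψ := ψ) (α ^ 2 * ν) β
  simp_rw [← gaussSum_mul_inv_apply hβ, mul_left_comm _ (gaussSum β ψ), ← Finset.mul_sum] at e
  have hα : (α ^ 2) (-1) = 1 := by
    rw [MulChar.pow_apply' _ two_ne_zero, sq, apply_neg_one_mul_self]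
  have hγ : (α ^ 2 * β⁻¹)⁻¹ * ν⁻¹ = β * (α ^ 2 * ν)⁻¹ := by
    rw [eq_mul_inv_iff_mul_eq]
    simp [mul_comm, mul_left_comm, mul_assoc]
  rw [MulChar.mul_apply, hα] at e
  rw [sq, mul_assoc, mul_sum_mul_sum_comm]
  simp_rw [h]
  rw [← Finset.mul_sum, mul_left_comm, e, hγ]
  linear_combination (gaussSum ν⁻¹ ψ * gaussSum (β * ν) ψ * gaussSum (α ^ 2 * ν) ψ *
    gaussSum (β * (α ^ 2 * ν)⁻¹) ψ) * apply_neg_one_mul_self ν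

lemma mellin_quadratic_sum (hp : ringChar κ ≠ 2) (α : MulChar κ ℂ) {β : MulChar κ ℂ}
    (hβ : β ≠ 1) (ν : MulChar κ ℂ) :
    gaussSum β ψ * ∑ x, ν⁻¹ x * ∑ s, (α ^ 2) s * β⁻¹ (1 - s + x * s ^ 2 / 4) =
      ν⁻¹ 4 * gaussSum ((α * ν) ^ 2) ψ * gaussSum ν⁻¹ ψ *
        gaussSum ((α ^ 2 * β⁻¹)⁻¹ * ν⁻¹) ψ := by
  have h2 : (2 : κ) ≠ 0 := Ring.two_ne_zero hp
  have h4 : (4 : κ) ≠ 0 := by convert mul_ne_zero h2 h2 using 1; norm_num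
  have h (s : κ) : gaussSum β ψ * ∑ x, ν⁻¹ x * ((α ^ 2) s * β⁻¹ (1 - s + x * s ^ 2 / 4)) =
      ν⁻¹ 4 * gaussSum ν⁻¹ ψ * (((α * ν) ^ 2) s * ∑ u, (β * ν) u * ψ ((1 - s) * u)) := by
    rcases eq_or_ne s 0 with rfl | hs
    · simp [MulChar.map_zero]
    have e := mellin_inv_affine (ψ := ψ) hβ ν (1 - s) (div_ne_zero (pow_ne_zero 2 hs) h4)
    simp_rw [← mul_div_assoc] at e
    rw [div_eq_mul_inv, map_mul, ← MulChar.inv_apply', map_pow] at e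
    simp_rw [mul_left_comm (ν⁻¹ _), ← Finset.mul_sum]
    rw [mul_left_comm, e, mul_pow, MulChar.mul_apply, MulChar.pow_apply' ν two_ne_zero]
    ring
  have hα : ((α * ν) ^ 2) (-1) = 1 := by
    rw [MulChar.pow_apply' _ two_ne_zero, sq, apply_neg_one_mul_self]
  have hγ : (α ^ 2 * β⁻¹)⁻¹ * ν⁻¹ = β * ν * ((α * ν) ^ 2)⁻¹ := by
    rw [eq_mul_inv_iff_mul_eq, mul_pow, sq ν]
    simp [mul_comm, mul_left_comm, mul_assoc]
  rw [mul_sum_mul_sum_comm]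
  simp_rw [h]
  rw [← Finset.mul_sum, sum_mul_sum_one_sub, hα, hγ]
  ring

lemma card_sub_one_ne_zero : (Fintype.card κ - 1 : ℂ) ≠ 0 := by
  have h : (Fintype.card κ : ℂ) ≠ 1 := by exact_mod_cast Fintype.one_lt_card.ne'
  exact sub_ne_zero.mpr h

/-- Euler's integral representation of `F(α², β; α²β⁻¹; l)`. -/
lemma Fh_eq_euler_sum (hψ : ψ ≠ 1) (α : MulChar κ ℂ) {β : MulChar κ ℂ} (hβ : β ≠ 1) {l : κ}
    (hl : l ≠ 0) : Fh ψ ![α ^ 2, β] ![α ^ 2 * β⁻¹] l =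
      gaussSum β ψ / (gaussSum (α ^ 2) ψ * gaussSum (α ^ 2 * β⁻¹)⁻¹ ψ) *
        ∑ t, (α ^ 2) t * (β⁻¹ (1 - t) * β⁻¹ (1 - l * t)) := by
  rw [Fh_two_one hψ, inv_mul_eq_iff_eq_mul₀ card_sub_one_ne_zero, mul_left_comm,
    ← sum_mellin_mul (fun x => ∑ t, (α ^ 2) t * (β⁻¹ (1 - t) * β⁻¹ (1 - x * t))) hl,
    Finset.mul_sum]
  refine Finset.sum_congr rfl fun ν _ => ?_
  rw [← mellin_euler_sum α hβ]
  have := gaussSum_ne_zero hψ β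
  field_simp

lemma Fh_eq_quadratic_sum (hp : ringChar κ ≠ 2) (hψ : ψ ≠ 1) {η : MulChar κ ℂ} (hη : η ^ 2 = 1)
    (hη1 : η ≠ 1) (α : MulChar κ ℂ) {β : MulChar κ ℂ} (hβ : β ≠ 1) {x : κ} (hx : x ≠ 0) :
    Fh ψ ![α, α * η] ![α ^ 2 * β⁻¹] x =
      gaussSum β ψ / (gaussSum (α ^ 2) ψ * gaussSum (α ^ 2 * β⁻¹)⁻¹ ψ) *
        ∑ s, (α ^ 2) s * β⁻¹ (1 - s + x * s ^ 2 / 4) := by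
  have h2 : (2 : κ) ≠ 0 := Ring.two_ne_zero hp
  have h4 : (4 : κ) ≠ 0 := by convert mul_ne_zero h2 h2 using 1; norm_num
  rw [Fh_two_one hψ, inv_mul_eq_iff_eq_mul₀ card_sub_one_ne_zero, mul_left_comm,
    ← sum_mellin_mul (fun x => ∑ s, (α ^ 2) s * β⁻¹ (1 - s + x * s ^ 2 / 4)) hx,
    Finset.mul_sum]
  refine Finset.sum_congr rfl fun ν _ => ?_
  have d1 := gaussSum_mul_gaussSum_quadratic hp hψ hη hη1 α
  have d2 := gaussSum_mul_gaussSum_quadratic hp hψ hη hη1 (α * ν)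
  have n1 := gaussSum_ne_zero hψ α
  have n2 := gaussSum_ne_zero hψ (α * η)
  have n3 := gaussSum_ne_zero hψ (α ^ 2)
  have n4 := gaussSum_ne_zero hψ η
  have nα : α 4 ≠ 0 := (h4.isUnit.map α).ne_zero
  have nν : ν 4 ≠ 0 := (h4.isUnit.map ν).ne_zero
  have hd : gaussSum (α * ν) ψ * gaussSum (α * η * ν) ψ / (gaussSum α ψ * gaussSum (α * η) ψ) =
      ν⁻¹ 4 * gaussSum ((α * ν) ^ 2) ψ / gaussSum (α ^ 2) ψ := by
    rw [mul_right_comm α η ν, MulChar.inv_apply_eq_inv', div_eq_div_iff (mul_ne_zero n1 n2) n3]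
    rw [MulChar.mul_apply] at d2
    refine mul_left_cancel₀ (mul_ne_zero (mul_ne_zero nα nν) n4) ?_
    linear_combination gaussSum (α ^ 2) ψ * gaussSum η ψ * d2 -
      gaussSum ((α * ν) ^ 2) ψ * gaussSum η ψ * d1 - α 4 * gaussSum η ψ *
      gaussSum ((α * ν) ^ 2) ψ * gaussSum α ψ * gaussSum (α * η) ψ * mul_inv_cancel₀ nν
  have hm := mellin_quadratic_sum (ψ := ψ) hp α hβ ν
  rw [mul_assoc (_ * _) (gaussSum ν⁻¹ ψ), mul_div_mul_comm, hd]
  linear_combination (-ν x / (gaussSum (α ^ 2) ψ * gaussSum (α ^ 2 * β⁻¹)⁻¹ ψ)) * hm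

end Gauss

/-- finite-field quadratic transformation of Gauss: in odd characteristic,
with `η` the quadratic character, `α² ≠ ε`, `β ≠ ε` and `λ ≠ -1`,
`α²(1+λ) F(α²,β;α²β̄;λ) = F(α,αη;α²β̄;1-((1-λ)/(1+λ))²)`. -/
theorem stmt_17 (hp : ringChar κ ≠ 2) (ψ : AddChar κ ℂ) (hψ : ψ ≠ 1)
    (η : MulChar κ ℂ) (hη2 : η ^ 2 = 1) (hη1 : η ≠ 1)
    (α β : MulChar κ ℂ) (hα : α ^ 2 ≠ 1) (hβ : β ≠ 1)
    (l : κ) (hl : l ≠ -1) :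
    (α ^ 2) (1 + l) * Fh ψ ![α ^ 2, β] ![α ^ 2 * β⁻¹] l =
      Fh ψ ![α, α * η] ![α ^ 2 * β⁻¹] (1 - ((1 - l) / (1 + l)) ^ 2) := by
  rcases eq_or_ne l 0 with rfl | hl0
  · simp [Fh, MulChar.map_zero]
  have hl1 : 1 + l ≠ 0 := fun h => hl (by linear_combination h)
  have h2 : (2 : κ) ≠ 0 := Ring.two_ne_zero hp
  have h4 : (4 : κ) ≠ 0 := by convert mul_ne_zero h2 h2 using 1; norm_num
  set x : κ := 1 - ((1 - l) / (1 + l)) ^ 2 with hx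
  have hx' : x = 4 * l / (1 + l) ^ 2 := by rw [hx]; field_simp; ring
  have hx0 : x ≠ 0 := by rw [hx']; exact div_ne_zero (mul_ne_zero h4 hl0) (pow_ne_zero 2 hl1)
  rw [Fh_eq_euler_sum hψ α hβ hl0, Fh_eq_quadratic_sum hp hψ hη2 hη1 α hβ hx0, mul_left_comm,
    Finset.mul_sum]
  congr 1
  refine Fintype.sum_bijective _ (mulLeft_bijective₀ (1 + l) hl1) _ _ fun t => ?_
  have : 1 - (1 + l) * t + x * ((1 + l) * t) ^ 2 / 4 = (1 - t) * (1 - l * t) := by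
    rw [hx']; field_simp; ring
  rw [this, map_mul, map_mul]
  ring

end
end
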